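/- Let P = RN be a parabolic subgroup of GL(n,F_q), 𝔻 a block-rook placement, and θ, θ' two disjoint characters of R°_𝔻 both invariant under the action of the subgroup S (preserving J_{𝔻,rt} and λ_𝔻 restricted to it). Then the induced characters χ_{𝔻,θ} = Ind_{P_𝔻}^P ξ_{𝔻,θ} and χ_{𝔻,θ'} = Ind_{P_𝔻}^P ξ_{𝔻,θ'} are disjoint (have no common irreducible constituent). -/

import Mathlib

open scoped BigOperators Classical

noncomputable section

variable (F : Type) [Field F] [Fintype F] [DecidableEq F]

def JSet {n s : ℕ} (f : Fin n → Fin s) : Set (Matrix (Fin n) (Fin n) F) :=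
  {x | ∀ i j, ¬ f i < f j → x i j = 0}

def NSet {n s : ℕ} (f : Fin n → Fin s) : Set (Matrix (Fin n) (Fin n) F) :=
  {a | ∃ x ∈ JSet F f, a = 1 + x}

def RSet {n s : ℕ} (f : Fin n → Fin s) : Set (Matrix (Fin n) (Fin n) F) :=
  {r | IsUnit r ∧ ∀ i j, f i ≠ f j → r i j = 0}

def ParSet {n s : ℕ} (f : Fin n → Fin s) : Set (Matrix (Fin n) (Fin n) F) :=
  {g | IsUnit g ∧ ∀ i j, f j < f i → g i j = 0}

def lamOf {n : ℕ} (Λ x : Matrix (Fin n) (Fin n) F) : F :=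
  ∑ i, ∑ j, Λ i j * x i j

def Jrt {n s : ℕ} (f : Fin n → Fin s) (Λ : Matrix (Fin n) (Fin n) F) :
    Set (Matrix (Fin n) (Fin n) F) :=
  {x | x ∈ JSet F f ∧ ∀ y ∈ JSet F f, lamOf F Λ (x * y) = 0}

def RcircSet {n s : ℕ} (f : Fin n → Fin s) (Λ : Matrix (Fin n) (Fin n) F) :
    Set (Matrix (Fin n) (Fin n) F) :=
  {r | r ∈ RSet F f ∧ ∀ x ∈ JSet F f,
    lamOf F Λ (r * x) = lamOf F Λ x ∧ lamOf F Λ (x * r) = lamOf F Λ x}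

def StabSet {n s : ℕ} (f : Fin n → Fin s) (Λ : Matrix (Fin n) (Fin n) F) :
    Set (Matrix (Fin n) (Fin n) F) :=
  {g | g ∈ ParSet F f ∧ (∀ x, x ∈ Jrt F f Λ ↔ g * x * g⁻¹ ∈ Jrt F f Λ) ∧
    ∀ x ∈ Jrt F f Λ, lamOf F Λ (g * x * g⁻¹) = lamOf F Λ x}

/-- `P_𝔻 = R°_𝔻 · N_{𝔻,rt}` (elements `r + x`). -/
def PD {n s : ℕ} (f : Fin n → Fin s) (Λ : Matrix (Fin n) (Fin n) F) :
    Set (Matrix (Fin n) (Fin n) F) :=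
  {g | ∃ r ∈ RcircSet F f Λ, ∃ x ∈ Jrt F f Λ, g = r + x}

/-- The inner product of functions on a subset `S` of a group of matrices. -/
def innerOn {n : ℕ} (S : Set (Matrix (Fin n) (Fin n) F))
    (φ ψ : Matrix (Fin n) (Fin n) F → ℂ) : ℂ :=
  (Nat.card S : ℂ)⁻¹ * ∑ᶠ g ∈ S, φ g * (starRingEnd ℂ) (ψ g)

/-- `χ` is the character of a representation of the (sub)group `S`. -/
def IsCharOn {n : ℕ} (S : Set (Matrix (Fin n) (Fin n) F))
    (χ : Matrix (Fin n) (Fin n) F → ℂ) : Prop :=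
  ∃ (d : ℕ) (T : Matrix (Fin n) (Fin n) F → Matrix (Fin d) (Fin d) ℂ),
    T 1 = 1 ∧ (∀ g ∈ S, ∀ h ∈ S, T (g * h) = T g * T h) ∧
    ∀ g ∈ S, χ g = Matrix.trace (T g)

/-- The character of `P` induced from the function `ξ` on `P_𝔻`. -/
def indCharOn {n : ℕ} (Psub Pbig : Set (Matrix (Fin n) (Fin n) F))
    (ξ : Matrix (Fin n) (Fin n) F → ℂ) : Matrix (Fin n) (Fin n) F → ℂ :=
  fun g => (Nat.card Psub : ℂ)⁻¹ *
    ∑ᶠ t ∈ Pbig, (if t⁻¹ * g * t ∈ Psub then ξ (t⁻¹ * g * t) else 0)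

namespace BlockRook

set_option linter.unusedSectionVars false

section

variable {F} {n s : ℕ} {f : Fin n → Fin s}

open Matrix

/-- Vanishing outside the diagonal blocks. -/
def IsBlockDiag (f : Fin n → Fin s) (M : Matrix (Fin n) (Fin n) F) : Prop :=
  ∀ i j, f i ≠ f j → M i j = 0

/-- The block diagonal part of a matrix. -/
def blockDiagPart (f : Fin n → Fin s) (M : Matrix (Fin n) (Fin n) F) :
    Matrix (Fin n) (Fin n) F :=
  Matrix.of fun i j => if f i = f j then M i j else 0

theorem IsBlockDiag.blockTriangular {M : Matrix (Fin n) (Fin n) F} (h : IsBlockDiag f M) :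
    M.BlockTriangular f := fun i j hij => h i j hij.ne'

theorem IsBlockDiag.mul {M K : Matrix (Fin n) (Fin n) F} (hM : IsBlockDiag f M)
    (hK : IsBlockDiag f K) : IsBlockDiag f (M * K) := by
  intro i j hij
  rw [Matrix.mul_apply]
  refine Finset.sum_eq_zero fun k _ => ?_
  by_cases h : f i = f k
  · rw [hK k j (h ▸ hij), mul_zero]
  · rw [hM i k h, zero_mul]

theorem IsBlockDiag.sub {M K : Matrix (Fin n) (Fin n) F} (hM : IsBlockDiag f M)
    (hK : IsBlockDiag f K) : IsBlockDiag f (M - K) := by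
  intro i j hij
  simp [hM i j hij, hK i j hij]

theorem IsBlockDiag.one : IsBlockDiag f (1 : Matrix (Fin n) (Fin n) F) := by
  intro i j hij
  exact Matrix.one_apply_ne fun h => hij (h ▸ rfl)

theorem isBlockDiag_blockDiagPart (M : Matrix (Fin n) (Fin n) F) :
    IsBlockDiag f (blockDiagPart f M) := by
  intro i j hij
  simp [blockDiagPart, hij]

theorem blockDiagPart_mul {M K : Matrix (Fin n) (Fin n) F} (hM : M.BlockTriangular f)
    (hK : K.BlockTriangular f) :
    blockDiagPart f (M * K) = blockDiagPart f M * blockDiagPart f K := by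
  ext i j
  rw [Matrix.mul_apply]
  simp only [blockDiagPart, Matrix.of_apply, Matrix.mul_apply]
  by_cases hij : f i = f j
  · rw [if_pos hij]
    refine Finset.sum_congr rfl fun k _ => ?_
    rcases lt_trichotomy (f i) (f k) with h | h | h
    · rw [hK (hij ▸ h), if_neg h.ne]; simp
    · rw [if_pos h, if_pos (h.symm.trans hij)]
    · rw [hM h, if_neg h.ne']; simp
  · rw [if_neg hij]
    refine (Finset.sum_eq_zero fun k _ => ?_).symm
    by_cases h : f i = f k
    · rw [if_neg (h ▸ hij : ¬ f k = f j), mul_zero]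
    · rw [if_neg h, zero_mul]

theorem blockDiagPart_one : blockDiagPart f (1 : Matrix (Fin n) (Fin n) F) = 1 := by
  ext i j
  by_cases h : f i = f j
  · simp [blockDiagPart, h]
  · simp [blockDiagPart, h, IsBlockDiag.one i j h]

theorem sub_blockDiagPart_mem {M : Matrix (Fin n) (Fin n) F} (hM : M.BlockTriangular f) :
    M - blockDiagPart f M ∈ JSet F f := by
  intro i j hij
  rcases (not_lt.1 hij).eq_or_lt with h | h
  · simp [blockDiagPart, h.symm]
  · simp [blockDiagPart, h.ne', hM h]

theorem mem_JSet_blockTriangular {x : Matrix (Fin n) (Fin n) F} (hx : x ∈ JSet F f) :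
    x.BlockTriangular f := fun i j hij => hx i j hij.not_gt

theorem mul_mem_JSet_left {g x : Matrix (Fin n) (Fin n) F} (hg : g.BlockTriangular f)
    (hx : x ∈ JSet F f) : g * x ∈ JSet F f := by
  intro i j hij
  rw [Matrix.mul_apply]
  refine Finset.sum_eq_zero fun k _ => ?_
  rcases lt_or_ge (f k) (f i) with h | h
  · rw [hg h, zero_mul]
  · rw [hx k j fun h' => hij (h.trans_lt h'), mul_zero]

theorem mul_mem_JSet_right {g x : Matrix (Fin n) (Fin n) F} (hg : g.BlockTriangular f)
    (hx : x ∈ JSet F f) : x * g ∈ JSet F f := by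
  intro i j hij
  rw [Matrix.mul_apply]
  refine Finset.sum_eq_zero fun k _ => ?_
  rcases lt_or_ge (f j) (f k) with h | h
  · rw [hg h, mul_zero]
  · rw [hx i k fun h' => hij (h'.trans_le h), zero_mul]

theorem add_mem_JSet {x y : Matrix (Fin n) (Fin n) F} (hx : x ∈ JSet F f) (hy : y ∈ JSet F f) :
    x + y ∈ JSet F f := fun i j hij => by simp [hx i j hij, hy i j hij]

theorem neg_mem_JSet {x : Matrix (Fin n) (Fin n) F} (hx : x ∈ JSet F f) :
    -x ∈ JSet F f := fun i j hij => by simp [hx i j hij]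

theorem smul_mem_JSet (c : F) {x : Matrix (Fin n) (Fin n) F} (hx : x ∈ JSet F f) :
    c • x ∈ JSet F f := fun i j hij => by simp [hx i j hij]

/-- `J` as a linear subspace. -/
def JSub (F : Type) [Field F] [Fintype F] [DecidableEq F] (f : Fin n → Fin s) :
    Submodule F (Matrix (Fin n) (Fin n) F) where
  carrier := JSet F f
  add_mem' := add_mem_JSet
  zero_mem' := fun _ _ _ => rfl
  smul_mem' := fun c _ hx => smul_mem_JSet c hx

theorem blockTriangular_one_add {x : Matrix (Fin n) (Fin n) F} (hx : x ∈ JSet F f) :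
    (1 + x).BlockTriangular f :=
  Matrix.blockTriangular_one.add (mem_JSet_blockTriangular hx)

theorem isUnit_one_add {x : Matrix (Fin n) (Fin n) F} (hx : x ∈ JSet F f) :
    IsUnit (1 + x) := by
  rw [Matrix.isUnit_iff_isUnit_det, (blockTriangular_one_add hx).det_fintype]
  have h : ∀ k, ((1 + x).toSquareBlock f k) = 1 := by
    intro k
    ext ⟨i, hi⟩ ⟨j, hj⟩
    have : x i j = 0 := hx i j (by rw [hi, hj]; exact lt_irrefl _)
    simp [Matrix.toSquareBlock, Matrix.toSquareBlockProp, this, Matrix.one_apply]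
  simp [h]

theorem blockTriangular_inv {g : Matrix (Fin n) (Fin n) F} (hg : g.BlockTriangular f) :
    g⁻¹.BlockTriangular f := by
  by_cases h : IsUnit g.det
  · have := Matrix.invertibleOfIsUnitDet g h
    exact Matrix.blockTriangular_inv_of_blockTriangular hg
  · rw [Matrix.nonsing_inv_apply_not_isUnit _ h]
    exact Matrix.blockTriangular_zero

theorem inv_one_add_sub_one_mem {x : Matrix (Fin n) (Fin n) F} (hx : x ∈ JSet F f) :
    (1 + x)⁻¹ - 1 ∈ JSet F f := by
  have h := (Matrix.isUnit_iff_isUnit_det _).1 (isUnit_one_add hx)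
  have h2 : (1 + x)⁻¹ - 1 = (1 + x)⁻¹ * (-x) := by
    have := Matrix.nonsing_inv_mul _ h
    rw [mul_add, mul_one] at this
    rw [mul_neg]
    exact eq_neg_of_add_eq_zero_left (by rw [sub_add_eq_add_sub, this, sub_self])
  rw [h2]
  exact mul_mem_JSet_left (blockTriangular_inv (blockTriangular_one_add hx)) (neg_mem_JSet hx)

theorem lamOf_eq_trace (Λ x : Matrix (Fin n) (Fin n) F) :
    lamOf F Λ x = (Λᵀ * x).trace := by
  simp only [lamOf, Matrix.trace, Matrix.diag, Matrix.mul_apply, Matrix.transpose_apply]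
  exact Finset.sum_comm

theorem lamOf_add (Λ x y : Matrix (Fin n) (Fin n) F) :
    lamOf F Λ (x + y) = lamOf F Λ x + lamOf F Λ y := by
  simp [lamOf_eq_trace, mul_add]

theorem lamOf_sub (Λ x y : Matrix (Fin n) (Fin n) F) :
    lamOf F Λ (x - y) = lamOf F Λ x - lamOf F Λ y := by
  simp [lamOf_eq_trace, mul_sub]

theorem lamOf_smul (Λ x : Matrix (Fin n) (Fin n) F) (c : F) :
    lamOf F Λ (c • x) = c * lamOf F Λ x := by
  simp [lamOf_eq_trace]

theorem blockTriangular_of_trace {M : Matrix (Fin n) (Fin n) F}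
    (h : ∀ x ∈ JSet F f, (M * x).trace = 0) : M.BlockTriangular f := by
  intro i j hij
  have := h (Matrix.single j i 1) (by
    intro a b hab
    rw [Matrix.single_apply, if_neg]
    rintro ⟨rfl, rfl⟩
    exact hab hij)
  simpa [Matrix.trace_mul_single] using this

theorem mul_mem_Jrt {Λ x g : Matrix (Fin n) (Fin n) F} (hx : x ∈ Jrt F f Λ)
    (hg : g.BlockTriangular f) : x * g ∈ Jrt F f Λ := by
  refine ⟨mul_mem_JSet_right hg hx.1, fun y hy => ?_⟩
  rw [mul_assoc]
  exact hx.2 _ (mul_mem_JSet_left hg hy)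

theorem add_mem_Jrt {Λ x y : Matrix (Fin n) (Fin n) F} (hx : x ∈ Jrt F f Λ)
    (hy : y ∈ Jrt F f Λ) : x + y ∈ Jrt F f Λ := by
  refine ⟨add_mem_JSet hx.1 hy.1, fun z hz => ?_⟩
  rw [add_mul, lamOf_add, hx.2 z hz, hy.2 z hz, add_zero]

theorem smul_mem_Jrt {Λ x : Matrix (Fin n) (Fin n) F} (c : F) (hx : x ∈ Jrt F f Λ) :
    c • x ∈ Jrt F f Λ := by
  refine ⟨smul_mem_JSet c hx.1, fun z hz => ?_⟩
  rw [smul_mul_assoc, lamOf_smul, hx.2 z hz, mul_zero]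

theorem neg_mem_Jrt {Λ x : Matrix (Fin n) (Fin n) F} (hx : x ∈ Jrt F f Λ) :
    -x ∈ Jrt F f Λ := by
  simpa using smul_mem_Jrt (-1 : F) hx

theorem mul_mem_Jrt_of_Rcirc {Λ r x : Matrix (Fin n) (Fin n) F} (hr : r ∈ RcircSet F f Λ)
    (hx : x ∈ Jrt F f Λ) : r * x ∈ Jrt F f Λ := by
  have hr' : IsBlockDiag f r := hr.1.2
  refine ⟨mul_mem_JSet_left hr'.blockTriangular hx.1, fun y hy => ?_⟩
  rw [mul_assoc, (hr.2 _ (mul_mem_JSet_right (mem_JSet_blockTriangular hy) hx.1)).1, hx.2 y hy]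

/-- A block triangular unit is a unipotent times a Levi element. -/
theorem exists_levi {t : Matrix (Fin n) (Fin n) F} (ht : t ∈ ParSet F f) :
    ∃ u v x : Matrix (Fin n) (Fin n) F, IsBlockDiag f u ∧ IsBlockDiag f v ∧ u * v = 1 ∧
      v * u = 1 ∧ x ∈ JSet F f ∧ t = (1 + x) * u := by
  have htri : t.BlockTriangular f := fun i j h => ht.2 i j h
  have h1 : t * t⁻¹ = 1 := Matrix.mul_nonsing_inv _ ((Matrix.isUnit_iff_isUnit_det _).1 ht.1)
  have huv : blockDiagPart f t * blockDiagPart f t⁻¹ = 1 := by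
    rw [← blockDiagPart_mul htri (blockTriangular_inv htri), h1, blockDiagPart_one]
  have hvu := mul_eq_one_comm.1 huv
  refine ⟨blockDiagPart f t, blockDiagPart f t⁻¹,
    (t - blockDiagPart f t) * blockDiagPart f t⁻¹, isBlockDiag_blockDiagPart _,
    isBlockDiag_blockDiagPart _, huv, hvu, ?_, ?_⟩
  · exact mul_mem_JSet_right (isBlockDiag_blockDiagPart _).blockTriangular
      (sub_blockDiagPart_mem htri)
  · rw [add_mul, mul_assoc, hvu, mul_one, one_mul]; abel

/-- Linear algebra: a functional killed by the common kernel of two families of functionals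
parametrised linearly is a sum of one member of each family. -/
theorem exists_eq_add_of_vanish {V W : Type*} [AddCommGroup V] [Module F V]
    [FiniteDimensional F V] [AddCommGroup W] [Module F W] [FiniteDimensional F W]
    (a b : W →ₗ[F] Module.Dual F V) (φ : Module.Dual F V)
    (h : ∀ v, (∀ w, a w v = 0) → (∀ w, b w v = 0) → φ v = 0) :
    ∃ w₁ w₂, φ = a w₁ + b w₂ := by
  have h1 : φ ∈ LinearMap.range a ⊔ LinearMap.range b := by
    rw [← Subspace.dualCoannihilator_dualAnnihilator_eq
      (W := LinearMap.range a ⊔ LinearMap.range b), Submodule.mem_dualAnnihilator]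
    intro v hv
    rw [Submodule.mem_dualCoannihilator] at hv
    exact h v (fun w => hv _ (Submodule.mem_sup_left ⟨w, rfl⟩))
      (fun w => hv _ (Submodule.mem_sup_right ⟨w, rfl⟩))
  obtain ⟨_, ⟨w₁, rfl⟩, _, ⟨w₂, rfl⟩, h2⟩ := Submodule.mem_sup.1 h1
  exact ⟨w₁, w₂, h2.symm⟩

/-- The features of a block-rook placement that matter: `Λ` is strictly block upper triangular,
and each row and each column of `Λ` meets a single block. -/
structure IsRook (f : Fin n → Fin s) (Λ : Matrix (Fin n) (Fin n) F) : Prop where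
  lt : ∀ i j, Λ i j ≠ 0 → f i < f j
  col : ∀ i i' j, Λ i j ≠ 0 → Λ i' j ≠ 0 → f i = f i'
  row : ∀ i j j', Λ i j ≠ 0 → Λ i j' ≠ 0 → f j = f j'

theorem IsRook.transpose_mul_eq_zero {Λ X y : Matrix (Fin n) (Fin n) F} (hΛ : IsRook f Λ)
    (hX : IsBlockDiag f X) (hy : y ∈ JSet F f)
    (h : (Λᵀ * (1 + y) * X).BlockTriangular f) : Λᵀ * X = 0 := by
  ext j q
  by_contra hne
  rw [Matrix.zero_apply, Matrix.mul_apply] at hne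
  obtain ⟨i, -, hi⟩ := Finset.exists_ne_zero_of_sum_ne_zero hne
  rw [Matrix.transpose_apply] at hi
  have hΛi := left_ne_zero_of_mul hi
  have hiq : f i = f q := by
    by_contra h'
    exact right_ne_zero_of_mul hi (hX i q h')
  have h0 := h (i := j) (j := q) (hiq ▸ hΛ.lt i j hΛi)
  apply hne
  rw [← h0, mul_assoc, Matrix.mul_apply]
  refine Finset.sum_congr rfl fun k _ => ?_
  rw [Matrix.transpose_apply]
  by_cases hk : Λ k j = 0
  · rw [hk, zero_mul, zero_mul]
  · have : (y * X) k q = 0 := mul_mem_JSet_right hX.blockTriangular hy k q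
      (by rw [hΛ.col k i j hk hΛi, hiq]; exact lt_irrefl _)
    rw [add_mul, one_mul, Matrix.add_apply, this, add_zero]

theorem IsRook.mul_transpose_eq_zero {Λ X y : Matrix (Fin n) (Fin n) F} (hΛ : IsRook f Λ)
    (hX : IsBlockDiag f X) (hy : y ∈ JSet F f)
    (h : (X * (1 + y) * Λᵀ).BlockTriangular f) : X * Λᵀ = 0 := by
  ext p i
  by_contra hne
  rw [Matrix.zero_apply, Matrix.mul_apply] at hne
  obtain ⟨j, -, hj⟩ := Finset.exists_ne_zero_of_sum_ne_zero hne
  rw [Matrix.transpose_apply] at hj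
  have hΛj := right_ne_zero_of_mul hj
  have hpj : f p = f j := by
    by_contra h'
    exact left_ne_zero_of_mul hj (hX p j h')
  have h0 := h (i := p) (j := i) (hpj ▸ hΛ.lt i j hΛj)
  apply hne
  rw [← h0, Matrix.mul_apply]
  refine Finset.sum_congr rfl fun k _ => ?_
  rw [Matrix.transpose_apply]
  by_cases hk : Λ i k = 0
  · rw [hk, mul_zero, mul_zero]
  · have : (X * y) p k = 0 := mul_mem_JSet_left hX.blockTriangular hy p k
      (by rw [hΛ.row i k j hk hΛj, hpj]; exact lt_irrefl _)
    rw [mul_add, mul_one, Matrix.add_apply, this, add_zero]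

theorem zero_mem_JSet : (0 : Matrix (Fin n) (Fin n) F) ∈ JSet F f := fun _ _ _ => rfl

theorem isBlockDiag_sub_one {Λ r : Matrix (Fin n) (Fin n) F} (hr : r ∈ RcircSet F f Λ) :
    IsBlockDiag f (r - 1) :=
  IsBlockDiag.sub hr.1.2 IsBlockDiag.one

theorem IsRook.transpose_mul_sub_one {Λ r : Matrix (Fin n) (Fin n) F} (hΛ : IsRook f Λ)
    (hr : r ∈ RcircSet F f Λ) : Λᵀ * (r - 1) = 0 := by
  refine hΛ.transpose_mul_eq_zero (isBlockDiag_sub_one hr) zero_mem_JSet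
    (blockTriangular_of_trace fun x hx => ?_)
  have := (hr.2 x hx).1
  rw [lamOf_eq_trace, lamOf_eq_trace] at this
  rw [add_zero, mul_one, mul_assoc, sub_mul, mul_sub, Matrix.trace_sub, this, one_mul, sub_self]

theorem IsRook.sub_one_mul_transpose {Λ r : Matrix (Fin n) (Fin n) F} (hΛ : IsRook f Λ)
    (hr : r ∈ RcircSet F f Λ) : (r - 1) * Λᵀ = 0 := by
  refine hΛ.mul_transpose_eq_zero (isBlockDiag_sub_one hr) zero_mem_JSet
    (blockTriangular_of_trace fun x hx => ?_)
  have := (hr.2 x hx).2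
  rw [lamOf_eq_trace, lamOf_eq_trace] at this
  rw [add_zero, mul_one, mul_assoc, Matrix.trace_mul_comm, mul_assoc, mul_sub, mul_sub,
    Matrix.trace_sub, this, mul_one, sub_self]

theorem mem_Rcirc_of {Λ r : Matrix (Fin n) (Fin n) F} (hr : r ∈ RSet F f)
    (h1 : Λᵀ * (r - 1) = 0) (h2 : (r - 1) * Λᵀ = 0) : r ∈ RcircSet F f Λ := by
  refine ⟨hr, fun x _ => ⟨?_, ?_⟩⟩
  · rw [lamOf_eq_trace, lamOf_eq_trace, ← sub_eq_zero, ← Matrix.trace_sub, ← mul_sub]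
    have : r * x - x = (r - 1) * x := by rw [sub_mul, one_mul]
    rw [this, ← mul_assoc, h1, zero_mul, Matrix.trace_zero]
  · rw [lamOf_eq_trace, lamOf_eq_trace, ← sub_eq_zero, ← Matrix.trace_sub, ← mul_sub]
    have : x * r - x = x * (r - 1) := by rw [mul_sub, mul_one]
    rw [this, ← mul_assoc, Matrix.trace_mul_comm, ← mul_assoc, h2, zero_mul, Matrix.trace_zero]

/-- If `λ` and its conjugate by `t` agree on `J_{rt} ∩ t J_{rt} t⁻¹`, then they lie in the same
orbit of right translations, once `t` is twisted by its Levi part. -/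
theorem exists_twist {Λ t u v a : Matrix (Fin n) (Fin n) F} (ht : t ∈ ParSet F f)
    (hv : IsBlockDiag f v) (hvu : v * u = 1)
    (ha : a ∈ JSet F f) (htu : t = (1 + a) * u)
    (h : ∀ x ∈ Jrt F f Λ, t⁻¹ * x * t ∈ Jrt F f Λ → lamOf F Λ (t⁻¹ * x * t) = lamOf F Λ x) :
    ∃ y ∈ JSet F f, ∀ x ∈ JSet F f,
      lamOf F Λ (t⁻¹ * x * u) = lamOf F Λ (x * (1 + y)) := by
  have htri : t.BlockTriangular f := fun i j h => ht.2 i j h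
  have htinv := blockTriangular_inv htri
  let α : JSub F f →ₗ[F] Module.Dual F (JSub F f) :=
    LinearMap.mk₂ F (fun y x => lamOf F Λ (x.1 * y.1))
      (by intros; simp [mul_add, lamOf_add]) (by intros; simp [lamOf_smul])
      (by intros; simp [add_mul, lamOf_add]) (by intros; simp [lamOf_smul])
  let β : JSub F f →ₗ[F] Module.Dual F (JSub F f) :=
    LinearMap.mk₂ F (fun y x => lamOf F Λ (t⁻¹ * (x.1 * y.1) * u))
      (by intros; simp [mul_add, add_mul, lamOf_add]) (by intros; simp [lamOf_smul])
      (by intros; simp [mul_add, add_mul, lamOf_add]) (by intros; simp [lamOf_smul])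
  let φ : Module.Dual F (JSub F f) :=
    { toFun := fun x => lamOf F Λ x.1 - lamOf F Λ (t⁻¹ * x.1 * u)
      map_add' := by intros; simp [mul_add, add_mul, lamOf_add]; ring
      map_smul' := by intros; simp [lamOf_smul]; ring }
  have ht2 : t⁻¹ * t = 1 :=
    Matrix.nonsing_inv_mul _ ((Matrix.isUnit_iff_isUnit_det _).1 ht.1)
  obtain ⟨⟨y, hy⟩, ⟨z, hz⟩, hyz⟩ := exists_eq_add_of_vanish α β φ (by
    rintro ⟨x, hx⟩ h1 h2
    have h1' : ∀ w ∈ JSet F f, lamOf F Λ (x * w) = 0 := fun w hw => h1 ⟨w, hw⟩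
    have h2' : ∀ w ∈ JSet F f, lamOf F Λ (t⁻¹ * (x * w) * u) = 0 := fun w hw => h2 ⟨w, hw⟩
    have hx1 : x ∈ Jrt F f Λ := ⟨hx, h1'⟩
    have hx2 : t⁻¹ * x * t ∈ Jrt F f Λ := by
      refine ⟨mul_mem_JSet_right htri (mul_mem_JSet_left htinv hx), fun w hw => ?_⟩
      rw [← h2' (t * w * v) (mul_mem_JSet_right hv.blockTriangular (mul_mem_JSet_left htri hw))]
      congr 1
      simp only [mul_assoc, hvu, mul_one]
    have h3 := h x hx1 hx2
    have h4 : t⁻¹ * x * t = t⁻¹ * x * u + t⁻¹ * (x * a) * u := by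
      calc t⁻¹ * x * t = t⁻¹ * x * ((1 + a) * u) := by rw [← htu]
        _ = _ := by noncomm_ring
    rw [h4, lamOf_add, h2' a ha, add_zero] at h3
    change lamOf F Λ x - lamOf F Λ (t⁻¹ * x * u) = 0
    rw [h3, sub_self])
  have key : ∀ x ∈ JSet F f, lamOf F Λ (x * (1 + -y)) = lamOf F Λ (t⁻¹ * (x * (1 + z)) * u) := by
    intro x hx
    have h5 : lamOf F Λ x - lamOf F Λ (t⁻¹ * x * u) =
        lamOf F Λ (x * y) + lamOf F Λ (t⁻¹ * (x * z) * u) :=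
      LinearMap.congr_fun hyz ⟨x, hx⟩
    have h6 : x * (1 + -y) = x - x * y := by noncomm_ring
    have h7 : t⁻¹ * (x * (1 + z)) * u = t⁻¹ * x * u + t⁻¹ * (x * z) * u := by noncomm_ring
    rw [h6, h7, lamOf_sub, lamOf_add]
    linear_combination h5
  have hz1 : (1 + z)⁻¹ * (1 + z) = 1 :=
    Matrix.nonsing_inv_mul _ ((Matrix.isUnit_iff_isUnit_det _).1 (isUnit_one_add hz))
  refine ⟨((1 + z)⁻¹ - 1) * (1 + -y) + -y, add_mem_JSet (mul_mem_JSet_right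
    (blockTriangular_one_add (neg_mem_JSet hy)) (inv_one_add_sub_one_mem hz)) (neg_mem_JSet hy),
    fun x hx => ?_⟩
  have h8 := key (x * (1 + z)⁻¹)
    (mul_mem_JSet_right (blockTriangular_inv (blockTriangular_one_add hz)) hx)
  rw [mul_assoc x, mul_assoc x, hz1, mul_one] at h8
  rw [← h8]
  congr 2
  noncomm_ring

/-- The agreement of `λ` and its conjugate forces `t` to lie in `S`. -/
theorem mem_StabSet_of_twist {Λ t u v y : Matrix (Fin n) (Fin n) F} (ht : t ∈ ParSet F f)
    (hu : IsBlockDiag f u) (hv : IsBlockDiag f v) (hvu : v * u = 1) (hy : y ∈ JSet F f)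
    (h : ∀ x ∈ Jrt F f Λ, t⁻¹ * x * t ∈ Jrt F f Λ → lamOf F Λ (t⁻¹ * x * t) = lamOf F Λ x)
    (htw : ∀ x ∈ JSet F f, lamOf F Λ (t⁻¹ * x * u) = lamOf F Λ (x * (1 + y))) :
    t ∈ StabSet F f Λ := by
  have htri : t.BlockTriangular f := fun i j h => ht.2 i j h
  have htinv := blockTriangular_inv htri
  have hdet := (Matrix.isUnit_iff_isUnit_det _).1 ht.1
  have ht2 : t⁻¹ * t = 1 := Matrix.nonsing_inv_mul _ hdet
  have ht1 : t * t⁻¹ = 1 := Matrix.mul_nonsing_inv _ hdet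
  have hy1 : (1 + y)⁻¹ * (1 + y) = 1 :=
    Matrix.nonsing_inv_mul _ ((Matrix.isUnit_iff_isUnit_det _).1 (isUnit_one_add hy))
  have hcanc : ∀ x : Matrix (Fin n) (Fin n) F, t⁻¹ * (t * x * t⁻¹) * t = x := by
    intro x
    rw [mul_assoc, mul_assoc (t * x), ht2, mul_one, ← mul_assoc, ht2, one_mul]
  have key : ∀ x ∈ JSet F f, ∀ w ∈ JSet F f,
      lamOf F Λ (t * x * t⁻¹ * (w * (1 + y))) = lamOf F Λ (x * (t⁻¹ * w * u)) := by
    intro x hx w hw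
    rw [← mul_assoc, ← htw _ (mul_mem_JSet_left (mem_JSet_blockTriangular
      (mul_mem_JSet_right htinv (mul_mem_JSet_left htri hx))) hw)]
    congr 1
    simp only [← mul_assoc, ht2, one_mul]
  have hiff : ∀ x, x ∈ Jrt F f Λ ↔ t * x * t⁻¹ ∈ Jrt F f Λ := by
    intro x
    constructor
    · intro hx
      refine ⟨mul_mem_JSet_right htinv (mul_mem_JSet_left htri hx.1), fun z hz => ?_⟩
      have hw : z * (1 + y)⁻¹ ∈ JSet F f :=
        mul_mem_JSet_right (blockTriangular_inv (blockTriangular_one_add hy)) hz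
      have := key x hx.1 _ hw
      rw [mul_assoc z, hy1, mul_one] at this
      rw [this]
      exact hx.2 _ (mul_mem_JSet_right hu.blockTriangular (mul_mem_JSet_left htinv hw))
    · intro hx
      have hxJ : x ∈ JSet F f := by
        rw [← hcanc x]
        exact mul_mem_JSet_right htri (mul_mem_JSet_left htinv hx.1)
      refine ⟨hxJ, fun z hz => ?_⟩
      have hw : t * z * v ∈ JSet F f :=
        mul_mem_JSet_right hv.blockTriangular (mul_mem_JSet_left htri hz)
      have := key x hxJ _ hw
      rw [hx.2 _ (mul_mem_JSet_right (blockTriangular_one_add hy) hw)] at this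
      rw [this]
      congr 2
      rw [mul_assoc, mul_assoc (t * z), hvu, mul_one, ← mul_assoc, ht2, one_mul]
  refine ⟨ht, hiff, fun x hx => ?_⟩
  have := h _ ((hiff x).1 hx) (by rwa [hcanc])
  rw [← this, hcanc]

/-- The Levi part of an element of `S` normalises `R°`, and conjugation by the element itself
differs from conjugation by its Levi part by an element of the kernel of `λ` in `J_{rt}`. -/
theorem conj_mem_of_twist {Λ t u v a y : Matrix (Fin n) (Fin n) F} (hΛ : IsRook f Λ)
    (ht : t ∈ ParSet F f) (hu : IsBlockDiag f u) (hv : IsBlockDiag f v) (huv : u * v = 1)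
    (ha : a ∈ JSet F f) (htu : t = (1 + a) * u) (hy : y ∈ JSet F f)
    (htw : ∀ x ∈ JSet F f, lamOf F Λ (t⁻¹ * x * u) = lamOf F Λ (x * (1 + y)))
    {r : Matrix (Fin n) (Fin n) F} (hr : r ∈ RcircSet F f Λ) :
    v * r * u ∈ RcircSet F f Λ ∧ ∃ z ∈ Jrt F f Λ, lamOf F Λ z = 0 ∧
      t⁻¹ * r * t = v * r * u + z := by
  have hvu : v * u = 1 := mul_eq_one_comm.1 huv
  have htri : t.BlockTriangular f := fun i j h => ht.2 i j h
  have hdet := (Matrix.isUnit_iff_isUnit_det _).1 ht.1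
  have ht2 : t⁻¹ * t = 1 := Matrix.nonsing_inv_mul _ hdet
  have hy1 : (1 + y)⁻¹ * (1 + y) = 1 :=
    Matrix.nonsing_inv_mul _ ((Matrix.isUnit_iff_isUnit_det _).1 (isUnit_one_add hy))
  have ha1 : (1 + a)⁻¹ * (1 + a) = 1 :=
    Matrix.nonsing_inv_mul _ ((Matrix.isUnit_iff_isUnit_det _).1 (isUnit_one_add ha))
  have htinv : t⁻¹ = v * (1 + a)⁻¹ := by
    apply Matrix.inv_eq_left_inv
    rw [htu, mul_assoc, ← mul_assoc _ (1 + a), ha1, one_mul, hvu]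
  set M := u * Λᵀ * t⁻¹ - (1 + y) * Λᵀ with hM
  have hMtri : M.BlockTriangular f := by
    refine blockTriangular_of_trace fun x hx => ?_
    have h1 := htw x hx
    rw [lamOf_eq_trace, lamOf_eq_trace] at h1
    rw [hM, sub_mul, Matrix.trace_sub, sub_eq_zero]
    calc (u * Λᵀ * t⁻¹ * x).trace = (u * (Λᵀ * t⁻¹ * x)).trace := by simp only [mul_assoc]
      _ = (Λᵀ * (t⁻¹ * x * u)).trace := by
        rw [Matrix.trace_mul_comm]; simp only [mul_assoc]
      _ = (Λᵀ * (x * (1 + y))).trace := h1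
      _ = ((1 + y) * Λᵀ * x).trace := by
        rw [← mul_assoc, Matrix.trace_mul_comm]; simp only [mul_assoc]
  have hML : u * Λᵀ * t⁻¹ = M + (1 + y) * Λᵀ := by rw [hM, sub_add_cancel]
  obtain ⟨ρ, hρ⟩ : ∃ ρ, ρ = r - 1 := ⟨_, rfl⟩
  have hρd : IsBlockDiag f ρ := hρ ▸ isBlockDiag_sub_one hr
  have hLρ : Λᵀ * ρ = 0 := hρ ▸ hΛ.transpose_mul_sub_one hr
  have hρL : ρ * Λᵀ = 0 := hρ ▸ hΛ.sub_one_mul_transpose hr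
  obtain ⟨X, hX⟩ : ∃ X, X = v * ρ * u := ⟨_, rfl⟩
  have hXd : IsBlockDiag f X := hX ▸ (hv.mul hρd).mul hu
  have huX : u * X = ρ * u := by rw [hX, ← mul_assoc, ← mul_assoc, huv, one_mul]
  have hconj : ∀ b ∈ JSet F f, v * b * u ∈ JSet F f := fun b hb =>
    mul_mem_JSet_right hu.blockTriangular (mul_mem_JSet_left hv.blockTriangular hb)
  obtain ⟨y₁, hy₁, hy₁e⟩ : ∃ y₁ ∈ JSet F f, t⁻¹ * u = 1 + y₁ := by
    refine ⟨_, hconj _ (inv_one_add_sub_one_mem ha), ?_⟩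
    rw [htinv, mul_sub, sub_mul, mul_one, hvu, add_sub_cancel]
  obtain ⟨y₃, hy₃, hy₃e⟩ : ∃ y₃ ∈ JSet F f, v * t = 1 + y₃ := by
    refine ⟨_, hconj _ ha, ?_⟩
    rw [htu, ← mul_assoc, mul_add, add_mul, mul_one, hvu]
  have hLX : Λᵀ * X = 0 := by
    refine hΛ.transpose_mul_eq_zero hXd hy₁ ?_
    have : Λᵀ * (1 + y₁) * X = v * M * (ρ * u) := by
      have e1 : Λᵀ * (1 + y₁) * X = v * (u * Λᵀ * t⁻¹) * (ρ * u) := by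
        rw [← hy₁e, mul_assoc, mul_assoc t⁻¹, huX]
        simp only [← mul_assoc, hvu, one_mul]
      rw [e1, hML, mul_add, add_mul, add_eq_left]
      calc v * ((1 + y) * Λᵀ) * (ρ * u) = v * (1 + y) * (Λᵀ * ρ) * u := by
            simp only [mul_assoc]
        _ = 0 := by rw [hLρ, mul_zero, zero_mul]
    rw [this]
    exact (hv.blockTriangular.mul hMtri).mul (hρd.mul hu).blockTriangular
  have hXL : X * Λᵀ = 0 := by
    have : ρ * u * Λᵀ = 0 := by
      refine hΛ.mul_transpose_eq_zero (hρd.mul hu)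
        (hconj _ (inv_one_add_sub_one_mem hy)) ?_
      have e0 : 1 + v * ((1 + y)⁻¹ - 1) * u = v * (1 + y)⁻¹ * u := by
        rw [mul_sub, sub_mul, mul_one, hvu, add_sub_cancel]
      have e1 : ρ * u * (1 + v * ((1 + y)⁻¹ - 1) * u) * Λᵀ =
          ρ * (1 + y)⁻¹ * (u * Λᵀ * t⁻¹) * t := by
        rw [e0]
        calc ρ * u * (v * (1 + y)⁻¹ * u) * Λᵀ = ρ * (u * v) * (1 + y)⁻¹ * u * Λᵀ := by
              simp only [mul_assoc]
          _ = ρ * (1 + y)⁻¹ * (u * Λᵀ * (t⁻¹ * t)) := by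
              rw [huv, ht2]; simp only [mul_assoc, mul_one]
          _ = _ := by simp only [mul_assoc]
      have e2 : ρ * (1 + y)⁻¹ * ((1 + y) * Λᵀ) = 0 := by
        rw [mul_assoc, ← mul_assoc _ (1 + y), hy1, one_mul, hρL]
      rw [e1, hML, mul_add, e2, add_zero]
      exact ((hρd.blockTriangular.mul
        (blockTriangular_inv (blockTriangular_one_add hy))).mul hMtri).mul htri
    rw [hX, mul_assoc, mul_assoc, ← mul_assoc ρ, this, mul_zero]
  have hvru : v * r * u = 1 + X := by
    rw [hX, hρ, mul_sub, sub_mul, mul_one, hvu, add_sub_cancel]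
  have hunit : ∀ {b c : Matrix (Fin n) (Fin n) F}, b * c = 1 → IsUnit b := fun h =>
    (Matrix.isUnit_iff_isUnit_det _).2 (Matrix.isUnit_det_of_right_inverse h)
  have hmem : v * r * u ∈ RcircSet F f Λ := by
    refine mem_Rcirc_of ⟨((hunit hvu).mul hr.1.1).mul (hunit huv), (hv.mul hr.1.2).mul hu⟩ ?_ ?_
    · rw [hvru, add_sub_cancel_left, hLX]
    · rw [hvru, add_sub_cancel_left, hXL]
  refine ⟨hmem, ?_⟩
  have hlamX : ∀ z, lamOf F Λ (X * z) = 0 := by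
    intro z
    rw [lamOf_eq_trace, ← mul_assoc, hLX, zero_mul, Matrix.trace_zero]
  have hXy₃ : X * y₃ ∈ Jrt F f Λ :=
    ⟨mul_mem_JSet_left hXd.blockTriangular hy₃, fun z _ => by rw [mul_assoc, hlamX]⟩
  have hy₁X : y₁ * X ∈ Jrt F f Λ := by
    refine ⟨mul_mem_JSet_right hXd.blockTriangular hy₁, fun z hz => ?_⟩
    have e1 : y₁ * X * z = t⁻¹ * (ρ * u * z * v) * u - X * z := by
      have e2 : t⁻¹ * (ρ * u * z * v) * u = (1 + y₁) * X * z := by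
        rw [← hy₁e, mul_assoc t⁻¹ u, huX]
        simp only [mul_assoc, hvu, mul_one]
      rw [e2, add_mul, add_mul, one_mul, add_sub_cancel_left]
    rw [e1, lamOf_sub, hlamX, sub_zero, htw _ (mul_mem_JSet_right hv.blockTriangular
      (mul_mem_JSet_left (hρd.mul hu).blockTriangular hz)), lamOf_eq_trace]
    have : Λᵀ * (ρ * u * z * v * (1 + y)) = Λᵀ * ρ * (u * z * v * (1 + y)) := by
      simp only [mul_assoc]
    rw [this, hLρ, zero_mul, Matrix.trace_zero]
  refine ⟨X * y₃ + y₁ * X * (1 + y₃), add_mem_Jrt hXy₃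
    (mul_mem_Jrt hy₁X (blockTriangular_one_add hy₃)), ?_, ?_⟩
  · rw [lamOf_add, hlamX, zero_add, mul_add, mul_one, lamOf_add, hy₁X.2 _ hy₃, add_zero,
      lamOf_eq_trace, ← mul_assoc, Matrix.trace_mul_comm, ← mul_assoc, hXL, zero_mul,
      Matrix.trace_zero]
  · have hr1 : r = 1 + ρ := by rw [hρ, add_sub_cancel]
    have e1 : t⁻¹ * r * t = 1 + t⁻¹ * u * X * (v * t) := by
      rw [mul_assoc t⁻¹ u, huX, hr1, mul_add, add_mul, mul_one, ht2]
      congr 1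
      calc t⁻¹ * ρ * t = t⁻¹ * ρ * (u * v) * t := by rw [huv, mul_one]
        _ = _ := by simp only [mul_assoc]
    rw [e1, hvru, hy₁e, hy₃e]
    noncomm_ring

theorem mem_PD_mul_one_add {Λ h x : Matrix (Fin n) (Fin n) F} (hh : h ∈ PD F f Λ)
    (hx : x ∈ Jrt F f Λ) : h * (1 + x) ∈ PD F f Λ := by
  obtain ⟨r, hr, y, hy, rfl⟩ := hh
  refine ⟨r, hr, y + (r * x + y * x), add_mem_Jrt hy (add_mem_Jrt (mul_mem_Jrt_of_Rcirc hr hx)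
    (mul_mem_Jrt hy (mem_JSet_blockTriangular hx.1))), ?_⟩
  noncomm_ring

theorem inv_one_add_sub_one_mem_Jrt {Λ x : Matrix (Fin n) (Fin n) F} (hx : x ∈ Jrt F f Λ) :
    ∃ x' ∈ Jrt F f Λ, (1 + x) * (1 + x') = 1 := by
  have h1 : (1 + x) * (1 + x)⁻¹ = 1 :=
    Matrix.mul_nonsing_inv _ ((Matrix.isUnit_iff_isUnit_det _).1 (isUnit_one_add hx.1))
  refine ⟨-x * (1 + x)⁻¹, mul_mem_Jrt (neg_mem_Jrt hx)
    (blockTriangular_inv (blockTriangular_one_add hx.1)), ?_⟩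
  have h2 : 1 + -x * (1 + x)⁻¹ = (1 + x)⁻¹ := by
    rw [add_mul, one_mul] at h1
    rw [neg_mul, ← sub_eq_add_neg]
    exact (eq_sub_of_add_eq h1).symm
  rw [h2, h1]

theorem mem_PD_mul_one_add_iff {Λ h x : Matrix (Fin n) (Fin n) F} (hx : x ∈ Jrt F f Λ) :
    h * (1 + x) ∈ PD F f Λ ↔ h ∈ PD F f Λ := by
  refine ⟨fun hh => ?_, fun hh => mem_PD_mul_one_add hh hx⟩
  obtain ⟨x', hx', he⟩ := inv_one_add_sub_one_mem_Jrt hx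
  have := mem_PD_mul_one_add hh hx'
  rwa [mul_assoc, he, mul_one] at this

/-- Extension by zero from `P_𝔻`. -/
def extendPD (f : Fin n → Fin s) (Λ : Matrix (Fin n) (Fin n) F)
    (ξ : Matrix (Fin n) (Fin n) F → ℂ) : Matrix (Fin n) (Fin n) F → ℂ :=
  fun h => if h ∈ PD F f Λ then ξ h else 0

theorem extendPD_mul_one_add {Λ : Matrix (Fin n) (Fin n) F} {ε : AddChar F ℂ}
    {θ ξ : Matrix (Fin n) (Fin n) F → ℂ}
    (hξ : ∀ r ∈ RcircSet F f Λ, ∀ x ∈ Jrt F f Λ, ξ (r + x) = θ r * ε (lamOf F Λ x))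
    (h : Matrix (Fin n) (Fin n) F) {x : Matrix (Fin n) (Fin n) F} (hx : x ∈ Jrt F f Λ) :
    extendPD f Λ ξ (h * (1 + x)) = extendPD f Λ ξ h * ε (lamOf F Λ x) := by
  by_cases hh : h ∈ PD F f Λ
  · simp only [extendPD]
    rw [if_pos hh, if_pos ((mem_PD_mul_one_add_iff hx).2 hh)]
    obtain ⟨r, hr, y, hy, rfl⟩ := hh
    have e1 : (r + y) * (1 + x) = r + (y + (r * x + y * x)) := by noncomm_ring
    rw [e1, hξ r hr _ (add_mem_Jrt hy (add_mem_Jrt (mul_mem_Jrt_of_Rcirc hr hx)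
      (mul_mem_Jrt hy (mem_JSet_blockTriangular hx.1)))), hξ r hr y hy, lamOf_add, lamOf_add,
      (hr.2 x hx.1).1, hy.2 x hx.1, add_zero, AddChar.map_add_eq_mul, mul_assoc]
  · simp only [extendPD]
    rw [if_neg hh, if_neg fun h' => hh ((mem_PD_mul_one_add_iff hx).1 h'), zero_mul]

theorem mul_mem_ParSet {g h : Matrix (Fin n) (Fin n) F} (hg : g ∈ ParSet F f)
    (hh : h ∈ ParSet F f) : g * h ∈ ParSet F f := by
  refine ⟨hg.1.mul hh.1, fun i j hij => ?_⟩
  exact Matrix.BlockTriangular.mul (b := f) (fun i j h => hg.2 i j h) (fun i j h => hh.2 i j h) hij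

theorem inv_mem_ParSet {g : Matrix (Fin n) (Fin n) F} (hg : g ∈ ParSet F f) :
    g⁻¹ ∈ ParSet F f := by
  refine ⟨Matrix.isUnit_nonsing_inv_iff.2 hg.1, fun i j hij => ?_⟩
  exact blockTriangular_inv (f := f) (fun i j h => hg.2 i j h) hij

theorem mul_inv_of_mem_ParSet {g : Matrix (Fin n) (Fin n) F} (hg : g ∈ ParSet F f) :
    g * g⁻¹ = 1 :=
  Matrix.mul_nonsing_inv _ ((Matrix.isUnit_iff_isUnit_det _).1 hg.1)

theorem inv_mul_of_mem_ParSet {g : Matrix (Fin n) (Fin n) F} (hg : g ∈ ParSet F f) :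
    g⁻¹ * g = 1 :=
  Matrix.nonsing_inv_mul _ ((Matrix.isUnit_iff_isUnit_det _).1 hg.1)

theorem one_add_mem_ParSet {x : Matrix (Fin n) (Fin n) F} (hx : x ∈ JSet F f) :
    1 + x ∈ ParSet F f :=
  ⟨isUnit_one_add hx, fun _ _ hij => blockTriangular_one_add hx hij⟩

theorem RSet_subset_ParSet {r : Matrix (Fin n) (Fin n) F} (hr : r ∈ RSet F f) :
    r ∈ ParSet F f :=
  ⟨hr.1, fun i j hij => hr.2 i j hij.ne'⟩

theorem PD_subset_ParSet {Λ h : Matrix (Fin n) (Fin n) F} (hh : h ∈ PD F f Λ) :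
    h ∈ ParSet F f := by
  obtain ⟨r, hr, x, hx, rfl⟩ := hh
  have hrP := RSet_subset_ParSet hr.1
  have : r + x = r * (1 + r⁻¹ * x) := by
    rw [mul_add, mul_one, ← mul_assoc, mul_inv_of_mem_ParSet hrP, one_mul]
  rw [this]
  exact mul_mem_ParSet hrP (one_add_mem_ParSet
    (mul_mem_JSet_left (fun i j h => (inv_mem_ParSet hrP).2 i j h) hx.1))

theorem one_mem_Rcirc {Λ : Matrix (Fin n) (Fin n) F} : 1 ∈ RcircSet F f Λ :=
  ⟨⟨isUnit_one, IsBlockDiag.one⟩, fun x _ => by rw [one_mul, mul_one]; exact ⟨rfl, rfl⟩⟩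

theorem sum_PD {Λ : Matrix (Fin n) (Fin n) F} (G : Matrix (Fin n) (Fin n) F → ℂ) :
    ∑ h with h ∈ PD F f Λ, G h =
      ∑ r with r ∈ RcircSet F f Λ, ∑ x with x ∈ Jrt F f Λ, G (r + x) := by
  rw [← Finset.sum_product']
  symm
  refine Finset.sum_bij (fun p _ => p.1 + p.2) ?_ ?_ ?_ ?_
  · rintro ⟨r, x⟩ hp
    simp only [Finset.mem_product, Finset.mem_filter, Finset.mem_univ, true_and] at hp ⊢
    exact ⟨r, hp.1, x, hp.2, rfl⟩
  · rintro ⟨r, x⟩ hp ⟨r', x'⟩ hp' he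
    simp only [Finset.mem_product, Finset.mem_filter, Finset.mem_univ, true_and] at hp hp' he
    have hrr : r = r' := by
      ext i j
      by_cases hij : f i = f j
      · have := congrFun (congrFun he i) j
        have h1 : x i j = 0 := hp.2.1 i j (by rw [hij]; exact lt_irrefl _)
        have h2 : x' i j = 0 := hp'.2.1 i j (by rw [hij]; exact lt_irrefl _)
        simpa [h1, h2] using this
      · rw [hp.1.1.2 i j hij, hp'.1.1.2 i j hij]
    subst hrr
    rw [add_left_cancel he]
  · intro h hh
    simp only [Finset.mem_filter, Finset.mem_univ, true_and] at hh
    obtain ⟨r, hr, x, hx, rfl⟩ := hh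
    exact ⟨(r, x), by simp [hr, hx], rfl⟩
  · intros; rfl

theorem sum_ParSet_mul_right {e : Matrix (Fin n) (Fin n) F} (he : e ∈ ParSet F f)
    (G : Matrix (Fin n) (Fin n) F → ℂ) :
    ∑ h with h ∈ ParSet F f, G (h * e) = ∑ h with h ∈ ParSet F f, G h := by
  refine Finset.sum_nbij' (fun h => h * e) (fun h => h * e⁻¹) ?_ ?_ ?_ ?_ ?_
  · intro h hh
    simp only [Finset.mem_filter, Finset.mem_univ, true_and] at hh ⊢
    exact mul_mem_ParSet hh he
  · intro h hh
    simp only [Finset.mem_filter, Finset.mem_univ, true_and] at hh ⊢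
    exact mul_mem_ParSet hh (inv_mem_ParSet he)
  · intro h _
    rw [mul_assoc, mul_inv_of_mem_ParSet he, mul_one]
  · intro h _
    rw [mul_assoc, inv_mul_of_mem_ParSet he, mul_one]
  · intros; rfl

theorem sum_ParSet_conj {t : Matrix (Fin n) (Fin n) F} (ht : t ∈ ParSet F f)
    (G : Matrix (Fin n) (Fin n) F → ℂ) :
    ∑ h with h ∈ ParSet F f, G (t⁻¹ * h * t) = ∑ h with h ∈ ParSet F f, G h := by
  have h1 := mul_inv_of_mem_ParSet ht
  have h2 := inv_mul_of_mem_ParSet ht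
  refine Finset.sum_nbij' (fun h => t⁻¹ * h * t) (fun h => t * h * t⁻¹) ?_ ?_ ?_ ?_ ?_
  · intro h hh
    simp only [Finset.mem_filter, Finset.mem_univ, true_and] at hh ⊢
    exact mul_mem_ParSet (mul_mem_ParSet (inv_mem_ParSet ht) hh) ht
  · intro h hh
    simp only [Finset.mem_filter, Finset.mem_univ, true_and] at hh ⊢
    exact mul_mem_ParSet (mul_mem_ParSet ht hh) (inv_mem_ParSet ht)
  · intro h _
    rw [← mul_assoc, ← mul_assoc, h1, one_mul, mul_assoc, h1, mul_one]
  · intro h _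
    rw [← mul_assoc, ← mul_assoc, h2, one_mul, mul_assoc, h2, mul_one]
  · intros; rfl

theorem addChar_mul_conj (ε : AddChar F ℂ) (a b : F) :
    ε a * (starRingEnd ℂ) (ε b) = ε (a - b) := by
  rw [← AddChar.map_neg_eq_conj, ← AddChar.map_add_eq_mul, sub_eq_add_neg]

/-- The Mackey summand attached to `t` vanishes. -/
theorem mackey_sum_eq_zero {Λ : Matrix (Fin n) (Fin n) F} (hΛ : IsRook f Λ)
    {ε : AddChar F ℂ} (hε : ∃ a, ε a ≠ 1)
    {θ θ' ξ ξ' : Matrix (Fin n) (Fin n) F → ℂ}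
    (hdisj : ∑ r with r ∈ RcircSet F f Λ, θ r * (starRingEnd ℂ) (θ' r) = 0)
    (hSinv : ∀ g₀ b t : Matrix (Fin n) (Fin n) F,
      g₀ ∈ StabSet F f Λ → b ∈ NSet F f → t ∈ RSet F f → g₀ = b * t →
        ∀ r ∈ RcircSet F f Λ, θ' (t * r * t⁻¹) = θ' r)
    (hξ : ∀ r ∈ RcircSet F f Λ, ∀ x ∈ Jrt F f Λ, ξ (r + x) = θ r * ε (lamOf F Λ x))
    (hξ' : ∀ r ∈ RcircSet F f Λ, ∀ x ∈ Jrt F f Λ, ξ' (r + x) = θ' r * ε (lamOf F Λ x))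
    {t : Matrix (Fin n) (Fin n) F} (ht : t ∈ ParSet F f) :
    ∑ h with h ∈ ParSet F f,
      extendPD f Λ ξ h * (starRingEnd ℂ) (extendPD f Λ ξ' (t⁻¹ * h * t)) = 0 := by
  have h1 := mul_inv_of_mem_ParSet ht
  have h2 := inv_mul_of_mem_ParSet ht
  by_cases hagree : ∀ x ∈ Jrt F f Λ, t⁻¹ * x * t ∈ Jrt F f Λ →
      lamOf F Λ (t⁻¹ * x * t) = lamOf F Λ x
  · obtain ⟨u, v, a, hu, hv, huv, hvu, ha, htu⟩ := exists_levi ht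
    obtain ⟨y, hy, htw⟩ := exists_twist ht hv hvu ha htu hagree
    have hS := mem_StabSet_of_twist ht hu hv hvu hy hagree htw
    have huR : u ∈ RSet F f :=
      ⟨(Matrix.isUnit_iff_isUnit_det _).2 (Matrix.isUnit_det_of_right_inverse huv), hu⟩
    have hterm : ∀ r ∈ RcircSet F f Λ, ∀ x ∈ Jrt F f Λ,
        ξ (r + x) * (starRingEnd ℂ) (extendPD f Λ ξ' (t⁻¹ * (r + x) * t)) =
          θ r * (starRingEnd ℂ) (θ' r) := by
      intro r hr x hx
      obtain ⟨hr', z, hz, hz0, hrz⟩ := conj_mem_of_twist hΛ ht hu hv huv ha htu hy htw hr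
      have hback : t * (t⁻¹ * x * t) * t⁻¹ = x := by
        rw [← mul_assoc, ← mul_assoc, h1, one_mul, mul_assoc, h1, mul_one]
      have hx' : t⁻¹ * x * t ∈ Jrt F f Λ := (hS.2.1 _).2 (by rwa [hback])
      have e1 : t⁻¹ * (r + x) * t = v * r * u + (z + t⁻¹ * x * t) := by
        rw [mul_add, add_mul, hrz, add_assoc]
      have hθ' : θ' (v * r * u) = θ' r := by
        rw [← hSinv t (1 + a) u hS ⟨a, ha, rfl⟩ huR htu _ hr', Matrix.inv_eq_right_inv huv]
        congr 1
        rw [← mul_assoc, ← mul_assoc, huv, one_mul, mul_assoc, huv, mul_one]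
      have hmem := add_mem_Jrt hz hx'
      rw [e1, extendPD, if_pos ⟨_, hr', _, hmem, rfl⟩, hξ r hr x hx, hξ' _ hr' _ hmem,
        lamOf_add, hz0, zero_add, hagree x hx hx', hθ', map_mul, mul_mul_mul_comm,
        addChar_mul_conj, sub_self, AddChar.map_zero_eq_one, mul_one]
    calc ∑ h with h ∈ ParSet F f,
          extendPD f Λ ξ h * (starRingEnd ℂ) (extendPD f Λ ξ' (t⁻¹ * h * t))
        = ∑ h with h ∈ PD F f Λ,
          ξ h * (starRingEnd ℂ) (extendPD f Λ ξ' (t⁻¹ * h * t)) := by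
          rw [Finset.sum_filter, Finset.sum_filter]
          refine Finset.sum_congr rfl fun h _ => ?_
          by_cases hh : h ∈ PD F f Λ
          · rw [if_pos hh, if_pos (PD_subset_ParSet hh), extendPD, if_pos hh]
          · rw [if_neg hh, extendPD, if_neg hh, zero_mul, ite_self]
      _ = ∑ r with r ∈ RcircSet F f Λ, ∑ x with x ∈ Jrt F f Λ,
          θ r * (starRingEnd ℂ) (θ' r) := by
          rw [sum_PD]
          refine Finset.sum_congr rfl fun r hr => Finset.sum_congr rfl fun x hx => ?_
          exact hterm r (Finset.mem_filter.1 hr).2 x (Finset.mem_filter.1 hx).2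
      _ = 0 := by
          rw [Finset.sum_comm]
          exact Finset.sum_eq_zero fun _ _ => hdisj
  · push Not at hagree
    obtain ⟨x₀, hx₀, hx₀', hne⟩ := hagree
    obtain ⟨b, hb⟩ := hε
    have hd : lamOf F Λ x₀ - lamOf F Λ (t⁻¹ * x₀ * t) ≠ 0 := sub_ne_zero.2 hne.symm
    obtain ⟨x, hx, hx', hxb⟩ : ∃ x ∈ Jrt F f Λ, t⁻¹ * x * t ∈ Jrt F f Λ ∧
        lamOf F Λ x - lamOf F Λ (t⁻¹ * x * t) = b := by
      refine ⟨(b / (lamOf F Λ x₀ - lamOf F Λ (t⁻¹ * x₀ * t))) • x₀, smul_mem_Jrt _ hx₀, ?_, ?_⟩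
      · rw [mul_smul_comm, smul_mul_assoc]
        exact smul_mem_Jrt _ hx₀'
      · rw [mul_smul_comm, smul_mul_assoc, lamOf_smul, lamOf_smul, ← mul_sub,
          div_mul_cancel₀ _ hd]
    have hstep := sum_ParSet_mul_right (one_add_mem_ParSet hx.1) fun h =>
      extendPD f Λ ξ h * (starRingEnd ℂ) (extendPD f Λ ξ' (t⁻¹ * h * t))
    have hmul : ∀ h, extendPD f Λ ξ (h * (1 + x)) *
        (starRingEnd ℂ) (extendPD f Λ ξ' (t⁻¹ * (h * (1 + x)) * t)) =
        extendPD f Λ ξ h * (starRingEnd ℂ) (extendPD f Λ ξ' (t⁻¹ * h * t)) * ε b := by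
      intro h
      have e1 : t⁻¹ * (h * (1 + x)) * t = t⁻¹ * h * t * (1 + t⁻¹ * x * t) := by
        have : t⁻¹ * h * t * (1 + t⁻¹ * x * t) =
            t⁻¹ * h * t + t⁻¹ * h * (t * t⁻¹) * x * t := by noncomm_ring
        rw [this, h1]; noncomm_ring
      rw [e1, extendPD_mul_one_add hξ h hx, extendPD_mul_one_add hξ' _ hx', map_mul,
        mul_mul_mul_comm, addChar_mul_conj, hxb]
    simp only [hmul] at hstep
    rw [← Finset.sum_mul] at hstep
    exact (mul_right_eq_self₀.1 hstep).resolve_left hb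

theorem finsum_mem_eq_sum_filter (S : Set (Matrix (Fin n) (Fin n) F))
    (G : Matrix (Fin n) (Fin n) F → ℂ) : ∑ᶠ g ∈ S, G g = ∑ g with g ∈ S, G g := by
  rw [finsum_mem_def, finsum_eq_sum_of_fintype, Finset.sum_filter]
  rfl

/-- Mackey's criterion in terms of the individual double coset representatives. -/
theorem innerOn_indCharOn_eq_zero {Λ : Matrix (Fin n) (Fin n) F}
    {ξ ξ' : Matrix (Fin n) (Fin n) F → ℂ}
    (h : ∀ t ∈ ParSet F f, ∑ h with h ∈ ParSet F f,
      extendPD f Λ ξ h * (starRingEnd ℂ) (extendPD f Λ ξ' (t⁻¹ * h * t)) = 0) :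
    innerOn F (ParSet F f) (indCharOn F (PD F f Λ) (ParSet F f) ξ)
      (indCharOn F (PD F f Λ) (ParSet F f) ξ') = 0 := by
  have hind : ∀ (η : Matrix (Fin n) (Fin n) F → ℂ) g,
      indCharOn F (PD F f Λ) (ParSet F f) η g = (Nat.card (PD F f Λ) : ℂ)⁻¹ *
        ∑ t with t ∈ ParSet F f, extendPD f Λ η (t⁻¹ * g * t) := by
    intro η g
    rw [indCharOn, finsum_mem_eq_sum_filter]
    rfl
  rw [innerOn, finsum_mem_eq_sum_filter]
  simp only [hind, map_mul, map_sum, mul_mul_mul_comm _ (Finset.sum _ _)]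
  rw [← Finset.mul_sum]
  simp only [Finset.sum_mul_sum]
  rw [Finset.sum_comm]
  have : ∀ t ∈ ({t | t ∈ ParSet F f} : Finset (Matrix (Fin n) (Fin n) F)),
      ∑ g with g ∈ ParSet F f, ∑ t' with t' ∈ ParSet F f,
        extendPD f Λ ξ (t⁻¹ * g * t) *
          (starRingEnd ℂ) (extendPD f Λ ξ' (t'⁻¹ * g * t')) = 0 := by
    intro t ht
    replace ht := (Finset.mem_filter.1 ht).2
    rw [Finset.sum_comm]
    refine Finset.sum_eq_zero fun t' ht' => ?_
    replace ht' := (Finset.mem_filter.1 ht').2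
    have h1 := mul_inv_of_mem_ParSet ht
    rw [← h (t⁻¹ * t') (mul_mem_ParSet (inv_mem_ParSet ht) ht'),
      ← sum_ParSet_conj ht fun h => extendPD f Λ ξ h *
        (starRingEnd ℂ) (extendPD f Λ ξ' ((t⁻¹ * t')⁻¹ * h * (t⁻¹ * t')))]
    refine Finset.sum_congr rfl fun g _ => ?_
    have e1 : (t⁻¹ * t')⁻¹ * (t⁻¹ * g * t) * (t⁻¹ * t') = t'⁻¹ * g * t' := by
      rw [Matrix.mul_inv_rev, Matrix.nonsing_inv_nonsing_inv _
        ((Matrix.isUnit_iff_isUnit_det _).1 ht.1)]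
      calc t'⁻¹ * t * (t⁻¹ * g * t) * (t⁻¹ * t') =
            t'⁻¹ * (t * t⁻¹) * g * (t * t⁻¹) * t' := by simp only [mul_assoc]
        _ = _ := by rw [h1, mul_one, mul_one]
    rw [e1]
  rw [Finset.sum_eq_zero this, mul_zero, mul_zero]

end

end BlockRook

/-- for disjoint `S`-invariant characters `θ, θ'` of `R°_𝔻`, the induced
characters `χ_{𝔻,θ}` and `χ_{𝔻,θ'}` of `P` are disjoint. -/
theorem stmt14 {n s : ℕ} (f : Fin n → Fin s)
    (hmono : Monotone f) (hsurj : Function.Surjective f)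
    (m : ℕ) (A B : Fin m → Finset (Fin n)) (hc : ∀ t, (B t).card = (A t).card)
    (hblocks : ∀ t, ∃ k l : Fin s, k < l ∧ (∀ i ∈ A t, f i = k) ∧ (∀ j ∈ B t, f j = l))
    (hdisjA : ∀ t t', t ≠ t' → Disjoint (A t) (A t'))
    (hdisjB : ∀ t t', t ≠ t' → Disjoint (B t) (B t'))
    (Λ : Matrix (Fin n) (Fin n) F)
    (hsupp : ∀ i j, Λ i j ≠ 0 → ∃ t, i ∈ A t ∧ j ∈ B t)
    (hinv : ∀ t, IsUnit (Matrix.of fun (a b : Fin (A t).card) =>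
      Λ (((A t).orderIsoOfFin rfl a : Fin n)) (((B t).orderIsoOfFin (hc t) b : Fin n))))
    (ε : AddChar F ℂ) (hε : ∃ a, ε a ≠ 1)
    (θ θ' : Matrix (Fin n) (Fin n) F → ℂ)
    (hθchar : IsCharOn F (RcircSet F f Λ) θ)
    (hθ'char : IsCharOn F (RcircSet F f Λ) θ')
    -- `θ` and `θ'` are disjoint characters of `R°_𝔻`
    (hdisjθ : innerOn F (RcircSet F f Λ) θ θ' = 0)
    -- `θ` and `θ'` are `S`-invariant
    (hSinv : ∀ g₀ b t : Matrix (Fin n) (Fin n) F,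
      g₀ ∈ StabSet F f Λ → b ∈ NSet F f → t ∈ RSet F f → g₀ = b * t →
        ∀ r ∈ RcircSet F f Λ, θ (t * r * t⁻¹) = θ r ∧ θ' (t * r * t⁻¹) = θ' r)
    (ξ ξ' : Matrix (Fin n) (Fin n) F → ℂ)
    (hξ : ∀ r ∈ RcircSet F f Λ, ∀ x ∈ Jrt F f Λ,
      ξ (r + x) = θ r * ε (lamOf F Λ x))
    (hξ' : ∀ r ∈ RcircSet F f Λ, ∀ x ∈ Jrt F f Λ,
      ξ' (r + x) = θ' r * ε (lamOf F Λ x)) :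
    innerOn F (ParSet F f)
      (indCharOn F (PD F f Λ) (ParSet F f) ξ)
      (indCharOn F (PD F f Λ) (ParSet F f) ξ') = 0 := by
  have hΛ : BlockRook.IsRook f Λ := by
    refine ⟨fun i j h => ?_, fun i i' j h h' => ?_, fun i j j' h h' => ?_⟩
    · obtain ⟨t, hi, hj⟩ := hsupp i j h
      obtain ⟨k, l, hkl, hA, hB⟩ := hblocks t
      rw [hA i hi, hB j hj]
      exact hkl
    · obtain ⟨t, hi, hj⟩ := hsupp i j h
      obtain ⟨t', hi', hj'⟩ := hsupp i' j h'
      obtain rfl : t = t' := by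
        by_contra hne
        exact Finset.disjoint_left.1 (hdisjB t t' hne) hj hj'
      obtain ⟨k, l, -, hA, -⟩ := hblocks t
      rw [hA i hi, hA i' hi']
    · obtain ⟨t, hi, hj⟩ := hsupp i j h
      obtain ⟨t', hi', hj'⟩ := hsupp i j' h'
      obtain rfl : t = t' := by
        by_contra hne
        exact Finset.disjoint_left.1 (hdisjA t t' hne) hi hi'
      obtain ⟨k, l, -, -, hB⟩ := hblocks t
      rw [hB j hj, hB j' hj']
  have hdisj : ∑ r with r ∈ RcircSet F f Λ, θ r * (starRingEnd ℂ) (θ' r) = 0 := by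
    rw [innerOn, BlockRook.finsum_mem_eq_sum_filter] at hdisjθ
    refine (mul_eq_zero.1 hdisjθ).resolve_left (inv_ne_zero (Nat.cast_ne_zero.2 ?_))
    have : Nonempty (RcircSet F f Λ) := ⟨⟨1, BlockRook.one_mem_Rcirc⟩⟩
    exact Nat.card_pos.ne'
  exact BlockRook.innerOn_indCharOn_eq_zero fun t ht =>
    BlockRook.mackey_sum_eq_zero hΛ hε hdisj
      (fun g₀ b t hg hb ht' he r hr => (hSinv g₀ b t hg hb ht' he r hr).2) hξ hξ' ht
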